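/- arXiv:1903.10460 — 4 statements merged into one kernel-verified Lean document; each statement's English description precedes it below -/
import Mathlib

section
/- Let S and T be finitely generated integral domains over a field k with T ⊆ S, and suppose there is an element σ ∈ T such that the localizations satisfy S[σ⁻¹] = T[σ⁻¹] (inside Frac S). Then Krull dim S = Krull dim T. -/
/-- An injective integral ring extension preserves the Krull dimension. -/
theorem ringKrullDim_eq_of_isIntegral (A B : Type*) [CommRing A] [CommRing B] [Algebra A B]
    [Algebra.IsIntegral A B] [FaithfulSMul A B] : ringKrullDim A = ringKrullDim B := by
  apply le_antisymm
  · refine iSup_le fun l ↦ ?_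
    obtain ⟨Q, -, hQ, hQl⟩ := Ideal.exists_ideal_over_prime_of_isIntegral l.head.asIdeal
      (⊥ : Ideal B) (by simp [← RingHom.ker_eq_comap_bot])
    have : Q.LiesOver l.head.asIdeal := ⟨hQl.symm⟩
    obtain ⟨L, hL, -⟩ := Ideal.exists_ltSeries_of_hasGoingUp l Q
    rw [← hL]
    exact Order.LTSeries.length_le_krullDim L
  · exact Order.krullDim_le_of_strictMono (PrimeSpectrum.comap (algebraMap A B)) fun p q hpq ↦
      Ideal.IsIntegral.comap_lt_comap (I := p.asIdeal) (J := q.asIdeal) hpq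

/-- A finitely generated domain over a field has Krull dimension equal to its transcendence
degree. -/
theorem ringKrullDim_eq_toENat_trdeg (k A : Type*) [Field k] [CommRing A] [IsDomain A]
    [Algebra k A] [Algebra.FiniteType k A] :
    ringKrullDim A = Cardinal.toENat (Algebra.trdeg k A) := by
  obtain ⟨s, g, hg, hint⟩ := exists_integral_inj_algHom_of_fg k A
  algebraize [g.toRingHom]
  have : IsScalarTower k (MvPolynomial (Fin s) k) A := .of_algebraMap_eq' g.comp_algebraMap.symm
  have : FaithfulSMul (MvPolynomial (Fin s) k) A :=
    (faithfulSMul_iff_algebraMap_injective _ _).mpr hg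
  have htr := lift_trdeg_add_eq k (MvPolynomial (Fin s) k) A
  rw [trdeg_eq_zero (R := MvPolynomial (Fin s) k), MvPolynomial.trdeg_of_isDomain] at htr
  have htr' := congrArg Cardinal.toENat htr
  simp only [Cardinal.mk_fin, Cardinal.lift_natCast, Cardinal.lift_zero, add_zero,
    Cardinal.toENat_nat, Cardinal.toENat_lift] at htr'
  rw [← ringKrullDim_eq_of_isIntegral (MvPolynomial (Fin s) k) A,
    MvPolynomial.ringKrullDim_of_isNoetherianRing, ← htr']
  simp


/-- Let `S` be a finitely generated integral domain over a field `k` and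
`T ⊆ S` a finitely generated subalgebra. If there is a nonzero `σ ∈ T` with
`S[σ⁻¹] = T[σ⁻¹]` inside `Frac S`, then `S` and `T` have the same Krull dimension. -/
theorem stmt_11 (k : Type*) [Field k]
    (S : Type*) [CommRing S] [IsDomain S] [Algebra k S] [Algebra.FiniteType k S]
    (T : Subalgebra k S) (hTfg : T.FG)
    (σ : S) (hσT : σ ∈ T) (hσ : σ ≠ 0)
    (h : {x : FractionRing S | ∃ s : S, ∃ n : ℕ,
            x = algebraMap S (FractionRing S) s / algebraMap S (FractionRing S) σ ^ n}
        = {x : FractionRing S | ∃ t ∈ T, ∃ n : ℕ,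
            x = algebraMap S (FractionRing S) t / algebraMap S (FractionRing S) σ ^ n}) :
    ringKrullDim S = ringKrullDim T := by
  have : Algebra.FiniteType k T := T.fg_iff_finiteType.mp hTfg
  have hσ' : algebraMap S (FractionRing S) σ ≠ 0 := by simpa using hσ
  have : Algebra.IsAlgebraic T S := ⟨fun s ↦ by
    obtain ⟨t, ht, n, hst⟩ := h.subset ⟨s, 0, rfl⟩
    have key : s * σ ^ n = t := by
      apply IsFractionRing.injective S (FractionRing S)
      rw [pow_zero, div_one, eq_div_iff (pow_ne_zero n hσ')] at hst
      simpa using hst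
    refine ⟨Polynomial.C ⟨σ, hσT⟩ ^ n * Polynomial.X - Polynomial.C ⟨t, ht⟩, fun h0 ↦ ?_, ?_⟩
    · have h1 := congrArg (fun p ↦ Polynomial.coeff p 1) h0
      rw [← Polynomial.C_pow] at h1
      have h2 := congrArg Subtype.val (by simpa [Polynomial.coeff_C] using h1)
      exact pow_ne_zero n hσ h2
    · simp [← key, mul_comm]⟩
  rw [ringKrullDim_eq_toENat_trdeg k S, ringKrullDim_eq_toENat_trdeg k T,
    ← trdeg_add_eq k T (A := S), trdeg_eq_zero (R := T), add_zero]
end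

section
/- Let B be a polynomial ring over a field k, R ⊆ B a subalgebra spanned over k by a set of monomials, m₀ ⊂ R the maximal ideal of elements with zero constant term, and g ∈ B a monomial with gⁿ ∉ R for all n ≥ 1. Suppose hₙ := gⁿσ^m ∈ R for all n ≥ 1, where σ ∈ R is a fixed monomial and m ≥ 1. Then the chain of ideals (h₁) ⊆ (h₁,h₂) ⊆ (h₁,h₂,h₃) ⊆ ... in the localization R_{m₀} does not stabilize; in particular R_{m₀} is not noetherian. -/
open MvPolynomial

/-- If a power of a monomial lies outside a monomial subalgebra `R`, its coefficient in every
element of `R` is zero. -/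
theorem coeff_nsmul_eq_zero_of_pow_notMem {k τ : Type*} [Field k]
    {R : Subalgebra k (MvPolynomial τ k)}
    (hmono : ∀ f ∈ R, ∀ d : τ →₀ ℕ, (monomial d (coeff d f) : MvPolynomial τ k) ∈ R)
    {d : τ →₀ ℕ} {n : ℕ} (hn : (monomial d (1 : k)) ^ n ∉ R)
    {f : MvPolynomial τ k} (hf : f ∈ R) : coeff (n • d) f = 0 := by
  by_contra hc
  apply hn
  have := R.smul_mem (hmono f hf (n • d)) (coeff (n • d) f)⁻¹
  rwa [smul_monomial, smul_eq_mul, inv_mul_cancel₀ hc, ← one_pow n, ← monomial_pow] at this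

/-- Let `B = k[x₁,…,x_r]`, `R ⊆ B` a monomial subalgebra, `m₀` the maximal
ideal of `R` of elements with zero constant term, `σ ∈ R` a monomial, and `g ∈ B` a
monomial with `gⁿ ∉ R` for all `n ≥ 1` but `hₙ := gⁿσᵐ ∈ R` for all `n ≥ 1` (some fixed
`m ≥ 1`). Then the chain `(h₁) ⊆ (h₁,h₂) ⊆ …` of ideals of `R_{m₀}` does not stabilize;
in particular `R_{m₀}` is not noetherian. -/
theorem stmt_13 (k : Type*) [Field k] (r : ℕ)
    (R : Subalgebra k (MvPolynomial (Fin r) k))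
    (hmono : ∀ f ∈ R, ∀ d : Fin r →₀ ℕ, (monomial d (coeff d f) : MvPolynomial (Fin r) k) ∈ R)
    (m₀ : Ideal R) (hm₀ : ∀ f : R, f ∈ m₀ ↔ coeff 0 (f : MvPolynomial (Fin r) k) = 0)
    (hmax : m₀.IsMaximal)
    (σ : R) (e : Fin r →₀ ℕ) (hσ : (σ : MvPolynomial (Fin r) k) = monomial e (1 : k))
    (m : ℕ) (hm : 1 ≤ m)
    (d : Fin r →₀ ℕ) (g : MvPolynomial (Fin r) k) (hg : g = monomial d (1 : k))
    (hgn : ∀ n : ℕ, 1 ≤ n → g ^ n ∉ R)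
    (h : ℕ → R)
    (hh : ∀ n : ℕ, (h n : MvPolynomial (Fin r) k)
            = g ^ n * (σ : MvPolynomial (Fin r) k) ^ m) :
    (∀ N : ℕ, 1 ≤ N →
      Ideal.span ((fun i => algebraMap R (Localization (@Ideal.primeCompl _ _ m₀ hmax.isPrime))
          (h i)) '' {i | 1 ≤ i ∧ i ≤ N})
        < Ideal.span ((fun i => algebraMap R
            (Localization (@Ideal.primeCompl _ _ m₀ hmax.isPrime))
          (h i)) '' {i | 1 ≤ i ∧ i ≤ N + 1})) ∧
      ¬ IsNoetherianRing (Localization (@Ideal.primeCompl _ _ m₀ hmax.isPrime)) := by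
  have := hmax.isPrime
  have hmon : ∀ i, (h i : MvPolynomial (Fin r) k) = monomial (i • d + m • e) 1 := by
    intro i
    rw [hh, hg, hσ, monomial_pow, monomial_pow, monomial_mul]
    simp
  have hstrict : ∀ N : ℕ,
      Ideal.span ((fun i => algebraMap R (Localization m₀.primeCompl) (h i)) ''
          {i | 1 ≤ i ∧ i ≤ N})
        < Ideal.span ((fun i => algebraMap R (Localization m₀.primeCompl) (h i)) ''
          {i | 1 ≤ i ∧ i ≤ N + 1}) := by
    intro N
    refine lt_of_le_of_ne (Ideal.span_mono (Set.image_mono fun i hi => ⟨hi.1, by grind⟩))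
      fun heq => ?_
    have hmem : algebraMap R (Localization m₀.primeCompl) (h (N + 1)) ∈
        (Ideal.span (h '' {i | 1 ≤ i ∧ i ≤ N})).map
          (algebraMap R (Localization m₀.primeCompl)) := by
      rw [Ideal.map_span, Set.image_image, heq]
      exact Ideal.subset_span ⟨N + 1, ⟨by lia, le_rfl⟩, rfl⟩
    rw [IsLocalization.algebraMap_mem_map_algebraMap_iff m₀.primeCompl] at hmem
    obtain ⟨s, hs, hsmem⟩ := hmem
    have hzero : ∀ x ∈ Ideal.span (h '' {i | 1 ≤ i ∧ i ≤ N}), ∀ a : R,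
        coeff ((N + 1) • d + m • e) ((a * x : R) : MvPolynomial (Fin r) k) = 0 := by
      intro x hx
      induction hx using Submodule.span_induction with
      | mem x hx =>
        obtain ⟨i, ⟨-, hiN⟩, rfl⟩ := hx
        intro a
        have hsplit : (N + 1) • d + m • e = (N + 1 - i) • d + (i • d + m • e) := by
          rw [← add_assoc, ← add_smul, Nat.sub_add_cancel (by lia)]
        rw [MulMemClass.coe_mul, hmon, hsplit, coeff_mul_monomial, mul_one]
        exact coeff_nsmul_eq_zero_of_pow_notMem hmono (hg ▸ hgn _ (by lia)) a.2
      | zero => simp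
      | add x y _ _ hx hy =>
        intro a
        rw [mul_add, AddMemClass.coe_add, coeff_add, hx, hy, add_zero]
      | smul b x _ hx =>
        intro a
        rw [smul_eq_mul, ← mul_assoc]
        exact hx _
    have h0 := hzero _ hsmem 1
    rw [one_mul, MulMemClass.coe_mul, hmon] at h0
    have hcoeff := coeff_mul_monomial 0 ((N + 1) • d + m • e) (1 : k)
      (s : MvPolynomial (Fin r) k)
    rw [zero_add, h0, mul_one] at hcoeff
    exact hs ((hm₀ s).2 hcoeff.symm)
  refine ⟨fun N _ => hstrict N, fun hnoeth => ?_⟩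
  exact not_strictMono_of_wellFoundedGT _ (strictMono_nat_of_lt_succ hstrict)
end

section
/- Let k be a field, B = k[x,y,z,w], S = k[xz, xw, yz, yw] ⊆ B (the quadric cone), let σ = (xz)(yw) = (xw)(yz), and R = k + σS. Then R is nonnoetherian, Frac R = Frac S, and Krull dim R = Krull dim S = 3. -/
open MvPolynomial

theorem three_le_krullDim_of_lt {α : Type*} [Preorder α] {a b c d : α}
    (hab : a < b) (hbc : b < c) (hcd : c < d) : 3 ≤ Order.krullDim α := by
  let l : LTSeries α := ⟨3, ![a, b, c, d], fun i => by
    fin_cases i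
    exacts [hab, hbc, hcd]⟩
  exact Order.LTSeries.length_le_krullDim l

section Conductor

variable {k R S : Type*} [Field k] [CommRing R] [CommRing S] [Algebra k R] [Algebra k S]

/-- If multiplication by `σ` sends `S` into `R`, a prime of `R` avoiding `σ` is the contraction of a
prime of `S`, described explicitly. -/
theorem exists_prime_mem_iff_of_mul_mem (i : R →ₐ[k] S) (hi : Function.Injective i) (σ : R)
    (hσ : ∀ s, ∃ r, i r = i σ * s) (p : PrimeSpectrum R) (hp : σ ∉ p.asIdeal) :
    ∃ q : PrimeSpectrum S, ∀ s r, i r = i σ * s → (s ∈ q.asIdeal ↔ r ∈ p.asIdeal) := by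
  choose g hg using hσ
  have hgu : ∀ s r, i r = i σ * s → r = g s := fun s r h => hi (h.trans (hg s).symm)
  have hsmul : ∀ a b, σ * g (a * b) = g a * g b := fun a b => hi (by
    simp only [map_mul, hg]; ring)
  have key : ∀ a b, g (a * b) ∈ p.asIdeal ↔ g a ∈ p.asIdeal ∨ g b ∈ p.asIdeal := by
    intro a b
    rw [← p.2.mul_mem_iff_mem_or_mem, ← hsmul, p.2.mul_mem_iff_mem_or_mem]
    simp [hp]
  let q : Ideal S :=
    { carrier := {s | g s ∈ p.asIdeal}
      zero_mem' := by
        have : g 0 = 0 := (hgu 0 0 (by simp)).symm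
        simp [this]
      add_mem' := by
        intro a b ha hb
        have : g (a + b) = g a + g b := (hgu _ _ (by simp only [map_add, hg]; ring)).symm
        simp only [Set.mem_ofPred_eq] at ha hb ⊢
        rw [this]
        exact add_mem ha hb
      smul_mem' := by
        intro c a ha
        exact (key c a).2 (Or.inr ha) }
  have hq : q.IsPrime := by
    refine Ideal.isPrime_iff.2 ⟨?_, fun {a b} h => (key a b).1 h⟩
    rw [Ideal.ne_top_iff_one]
    intro h
    have h1 : g 1 = σ := (hgu 1 σ (by simp)).symm
    exact hp (h1 ▸ h)
  exact ⟨⟨q, hq⟩, fun s r h => by rw [hgu s r h]; rfl⟩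

theorem comap_isMaximal_of_finiteType [Algebra.FiniteType k S] (i : R →ₐ[k] S)
    (m : Ideal S) [hm : m.IsMaximal] : (m.comap i).IsMaximal := by
  let _ : Field (S ⧸ m) := Ideal.Quotient.field m
  have : Module.Finite k (S ⧸ m) := finite_of_finite_type_of_isJacobsonRing k (S ⧸ m)
  let f : R →ₐ[k] S ⧸ m := (Ideal.Quotient.mkₐ k m).comp i
  have hint : ((f : R →+* S ⧸ m).comp (algebraMap k R)).IsIntegral := by
    rw [AlgHom.comp_algebraMap]
    exact Algebra.IsIntegral.isIntegral
  have := Ideal.isMaximal_comap_of_isIntegral_of_isMaximal' (f : R →+* S ⧸ m)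
    (RingHom.IsIntegral.tower_top _ _ hint) ⊥
  convert this using 1
  ext x
  simp [f, Ideal.mem_comap, Ideal.Quotient.eq_zero_iff_mem]

/-- A subring `R` of an affine algebra `S` of the form `k + σS` has dimension at most `dim S`. -/
theorem ringKrullDim_le_of_eq_add_mul [Algebra.FiniteType k S] (i : R →ₐ[k] S)
    (hi : Function.Injective i) (σ : R) (hσ : ∀ s, ∃ r, i r = i σ * s)
    (hdec : ∀ r, ∃ (c : k) (s : S), i r = algebraMap k S c + i σ * s)
    {n : ℕ} (hn : ringKrullDim S ≤ n) : ringKrullDim R ≤ n := by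
  choose q hq using exists_prime_mem_iff_of_mul_mem i hi σ hσ
  have hcomap : ∀ p hp r, i r ∈ (q p hp).asIdeal ↔ r ∈ p.asIdeal := by
    intro p hp r
    rw [hq p hp (i r) (σ * r) (by simp), p.2.mul_mem_iff_mem_or_mem]
    simp [hp]
  have hqlt : ∀ p hp p' hp', p < p' → q p hp < q p' hp' := by
    intro p hp p' hp' hlt
    refine lt_of_le_of_ne ?_ ?_
    · intro s hs
      obtain ⟨r, hr⟩ := hσ s
      exact (hq p' hp' s r hr).2 (hlt.le ((hq p hp s r hr).1 hs))
    · intro heq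
      refine hlt.ne (PrimeSpectrum.ext (Ideal.ext fun r => ?_))
      rw [← hcomap p hp, ← hcomap p' hp', heq]
  have hheight : ∀ (n : ℕ) p hp, Order.height (q p hp) ≤ n → Order.height p ≤ n := by
    intro n
    induction n with
    | zero =>
      intro p hp h
      rw [Order.height_le_coe_iff] at h ⊢
      intro p' hlt
      exact absurd (h _ (hqlt p' (fun h => hp (hlt.le h)) p hp hlt)) (by simp)
    | succ n ih =>
      intro p hp h
      rw [Order.height_le_coe_iff] at h ⊢
      intro p' hlt
      have h1 := h _ (hqlt p' (fun h => hp (hlt.le h)) p hp hlt)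
      rw [Nat.cast_succ, ENat.lt_add_one_iff (by simp)] at h1 ⊢
      exact ih _ _ h1
  have hS : ∀ Q : PrimeSpectrum S, Order.height Q ≤ n := fun Q =>
    WithBot.coe_le_coe.1 ((Order.height_le_krullDim Q).trans hn)
  rw [ringKrullDim, Order.krullDim_eq_iSup_height]
  refine iSup_le fun p => WithBot.coe_le_coe.2 ?_
  by_cases hp : σ ∈ p.asIdeal
  · refine Order.height_le_coe_iff.2 fun p' hlt => ?_
    have hp' : σ ∉ p'.asIdeal := by
      intro hmem
      refine hlt.not_ge fun r hr => ?_
      obtain ⟨c, s, hcs⟩ := hdec r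
      obtain ⟨t, ht⟩ := hσ s
      obtain ⟨u, hu⟩ := hσ (s * s)
      have htp : t ∈ p'.asIdeal := by
        have h2 : t * t = σ * u := hi (by
          simp only [map_mul, hu, ht]; ring)
        have : t * t ∈ p'.asIdeal := h2 ▸ Ideal.mul_mem_right _ _ hmem
        exact (p'.2.mul_mem_iff_mem_or_mem.1 this).elim id id
      have hr' : r = algebraMap k R c + t := hi (by simp [hcs, ht])
      by_cases hc : c = 0
      · simpa [hr', hc] using htp
      · exfalso
        have hcm : algebraMap k R c ∈ p.asIdeal := by
          have := sub_mem hr (hlt.le htp)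
          simpa [hr'] using this
        exact p.2.ne_top (Ideal.eq_top_of_isUnit_mem _ hcm ((IsUnit.mk0 c hc).map _))
    obtain ⟨m, hm, hqm⟩ := Ideal.exists_le_maximal _ (q p' hp').2.ne_top
    have hlt' : q p' hp' < ⟨m, hm.isPrime⟩ := by
      refine lt_of_le_of_ne hqm ?_
      intro heq
      have hmax := comap_isMaximal_of_finiteType i m
      have : p'.asIdeal = m.comap i := by
        ext r
        rw [← hcomap p' hp', heq]
        rfl
      rw [← this] at hmax
      exact hlt.ne (PrimeSpectrum.ext (hmax.eq_of_le p.2.ne_top hlt.le))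
    have h1 : Order.height (q p' hp') < n := Order.height_le_coe_iff.1 (hS _) _ hlt'
    obtain ⟨a, ha⟩ := ENat.ne_top_iff_exists.1 h1.ne_top
    exact (hheight a p' hp' ha.ge).trans_lt (ha ▸ h1)
  · exact hheight n p hp (hS _)

end Conductor

theorem isIntegral_of_mul_mem_range {A B : Type*} [CommRing A] [IsNoetherianRing A] [CommRing B]
    [IsDomain B] [Algebra A B] (T : Subalgebra A B) {σ : B} (hσ : σ ≠ 0)
    (h : ∀ t ∈ T, σ * t ∈ (Algebra.linearMap A B).range) {x : B} (hx : x ∈ T) :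
    IsIntegral A x := by
  let g : Subalgebra.toSubmodule T →ₗ[A] (Algebra.linearMap A B).range :=
    ((LinearMap.mulLeft A σ).comp (Subalgebra.toSubmodule T).subtype).codRestrict _
      fun t => h t t.2
  have hg : Function.Injective g := fun a b hab =>
    Subtype.ext (mul_left_cancel₀ hσ (congrArg Subtype.val hab))
  have : IsNoetherian A (Algebra.linearMap A B).range :=
    isNoetherian_of_surjective (Algebra.linearMap A B).rangeRestrict
      (LinearMap.range_rangeRestrict _)
  exact isIntegral_of_submodule_noetherian T (isNoetherian_of_injective g hg) x hx

section QuadricCone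

variable {k : Type*} [Field k]

/-- The primes of a subalgebra cut out by `x = y`, then `x = y, z = w`, then the origin. -/
theorem three_le_ringKrullDim_subalgebra (A : Subalgebra k (MvPolynomial (Fin 4) k))
    (h1 : X 0 * X 1 * X 2 * X 3 * (X 0 * X 2 - X 1 * X 2) ∈ A)
    (h2 : X 0 * X 1 * X 2 * X 3 * (X 0 * X 2 - X 0 * X 3) ∈ A)
    (h3 : X 0 * X 1 * X 2 * X 3 ∈ A) : 3 ≤ ringKrullDim A := by
  let e (v : Fin 4 → MvPolynomial (Fin 4) k) : PrimeSpectrum A :=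
    ⟨RingHom.ker ((aeval v).comp A.val), RingHom.ker_isPrime _⟩
  have mem : ∀ v f, f ∈ (e v).asIdeal ↔ aeval v (f : MvPolynomial (Fin 4) k) = 0 :=
    fun v f => Iff.rfl
  have lt : ∀ u v w : Fin 4 → MvPolynomial (Fin 4) k, (∀ j, aeval w (u j) = v j) →
      ∀ f ∈ A, aeval v f = 0 → aeval u f ≠ 0 → e u < e v := by
    intro u v w huv f hf hv hu
    refine lt_of_le_not_ge ?_ fun hle => hu (hle (x := ⟨f, hf⟩) hv)
    intro g hg
    have hcomp : (aeval w).comp (aeval u) = (aeval v : MvPolynomial (Fin 4) k →ₐ[k] _) := by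
      ext1 j
      simpa using huv j
    rw [mem] at hg ⊢
    rw [← hcomp, AlgHom.comp_apply, hg, map_zero]
  have hne : ∀ a b : Fin 4, a ≠ b → (X a - X b : MvPolynomial (Fin 4) k) ≠ 0 :=
    fun a b hab => sub_ne_zero.2 fun h => hab (X_injective h)
  refine three_le_krullDim_of_lt
    (lt X ![X 0, X 0, X 2, X 3] ![X 0, X 0, X 2, X 3] ?_ _ h1 ?_ ?_)
    (lt _ ![X 0, X 0, X 2, X 2] ![X 0, X 0, X 2, X 2] ?_ _ h2 ?_ ?_)
    (lt _ ![0, 0, 0, 0] ![0, 0, 0, 0] ?_ _ h3 ?_ ?_)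
  · simp
  · simp
  · rw [← sub_mul]
    simp [hne]
  · simp [Fin.forall_fin_succ]
  · simp
  · rw [← mul_sub]
    simp [hne]
  · simp [Fin.forall_fin_succ]
  · simp
  · simp

theorem ringKrullDim_quadricCone_le :
    ringKrullDim (Algebra.adjoin k
      ({X 0 * X 2, X 0 * X 3, X 1 * X 2, X 1 * X 3} : Set (MvPolynomial (Fin 4) k))) ≤ 3 := by
  let v : Fin 4 → MvPolynomial (Fin 4) k := ![X 0 * X 2, X 0 * X 3, X 1 * X 2, X 1 * X 3]
  have hv : Set.range v = {X 0 * X 2, X 0 * X 3, X 1 * X 2, X 1 * X 3} := by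
    ext f
    simp [v]
    tauto
  rw [← hv, Algebra.adjoin_range_eq_range_aeval]
  have hr : (X 0 * X 3 - X 1 * X 2 : MvPolynomial (Fin 4) k) ≠ 0 := by
    intro h
    have := congrArg (aeval (![1, 0, 0, 1] : Fin 4 → k)) h
    simp at this
  have h := ringKrullDim_succ_le_of_surjective
    (aeval (R := k) v).rangeRestrict.toRingHom
    (aeval (R := k) v).rangeRestrict_surjective (mem_nonZeroDivisors_of_ne_zero hr)
    (by
      apply Subtype.ext
      change aeval v (X 0 * X 3 - X 1 * X 2) = 0
      simp only [map_sub, map_mul, aeval_X, v, Matrix.cons_val]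
      ring)
  rw [MvPolynomial.ringKrullDim_of_isNoetherianRing, ringKrullDim_eq_zero_of_field] at h
  have h4 : (0 + (Nat.card (Fin 4) : ℕ) : WithBot ℕ∞) = 3 + 1 := by
    simp; norm_num
  rw [h4] at h
  exact (ENat.WithBot.add_le_add_one_right_iff).1 h

end QuadricCone

/-- Let `B = k[x,y,z,w]`, `S = k[xz,xw,yz,yw] ⊆ B` the coordinate ring of
the quadric cone, `σ = xyzw = (xz)(yw) = (xw)(yz)`, and `R = k + σS`. Then `R` is
nonnoetherian, `Frac R = Frac S` (inside `Frac B`), and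
`Krull dim R = Krull dim S = 3`. -/
theorem stmt_18 (k : Type*) [Field k]
    (σ : MvPolynomial (Fin 4) k) (hσ : σ = X 0 * X 1 * X 2 * X 3)
    (S : Subalgebra k (MvPolynomial (Fin 4) k))
    (hS : S = Algebra.adjoin k
      {X 0 * X 2, X 0 * X 3, X 1 * X 2, X 1 * X 3})
    (R : Subalgebra k (MvPolynomial (Fin 4) k))
    (hR : R = Algebra.adjoin k {f : MvPolynomial (Fin 4) k | ∃ s ∈ S, f = σ * s})
    (φ : MvPolynomial (Fin 4) k → FractionRing (MvPolynomial (Fin 4) k))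
    (hφ : φ = algebraMap (MvPolynomial (Fin 4) k) (FractionRing (MvPolynomial (Fin 4) k))) :
    ¬ IsNoetherianRing R ∧
      {x : FractionRing (MvPolynomial (Fin 4) k) |
          ∃ a ∈ R, ∃ b ∈ R, b ≠ 0 ∧ x = φ a / φ b}
        = {x : FractionRing (MvPolynomial (Fin 4) k) |
          ∃ a ∈ S, ∃ b ∈ S, b ≠ 0 ∧ x = φ a / φ b} ∧
      ringKrullDim R = ringKrullDim S ∧ ringKrullDim S = 3 := by
  have hgen : ∀ f ∈ ({X 0 * X 2, X 0 * X 3, X 1 * X 2, X 1 * X 3} :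
      Set (MvPolynomial (Fin 4) k)), f ∈ S := fun f hf => hS ▸ Algebra.subset_adjoin hf
  have hσS : σ ∈ S := by
    have : σ = (X 0 * X 2) * (X 1 * X 3) := by rw [hσ]; ring
    rw [this]
    exact mul_mem (hgen _ (by simp)) (hgen _ (by simp))
  have hσR : ∀ s ∈ S, σ * s ∈ R := fun s hs => hR ▸ Algebra.subset_adjoin ⟨s, hs, rfl⟩
  have hσ0 : σ ≠ 0 := by simp [hσ]
  have hσmem : σ ∈ R := by simpa using hσR 1 (one_mem S)
  have hRS : R ≤ S := by
    rw [hR, Algebra.adjoin_le_iff]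
    rintro _ ⟨s, hs, rfl⟩
    exact mul_mem hσS hs
  have hdec : ∀ r ∈ R, ∃ c : k, ∃ s ∈ S, r = C c + σ * s := by
    intro r hr
    rw [hR] at hr
    induction hr using Algebra.adjoin_induction with
    | mem f hf =>
      obtain ⟨s, hs, rfl⟩ := hf
      exact ⟨0, s, hs, by simp⟩
    | algebraMap c => exact ⟨c, 0, zero_mem S, by simp [algebraMap_eq]⟩
    | add f g _ _ hf hg =>
      obtain ⟨c, s, hs, rfl⟩ := hf
      obtain ⟨d, t, ht, rfl⟩ := hg
      exact ⟨c + d, s + t, add_mem hs ht, by rw [C_add]; ring⟩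
    | mul f g _ _ hf hg =>
      obtain ⟨c, s, hs, rfl⟩ := hf
      obtain ⟨d, t, ht, rfl⟩ := hg
      have hC : ∀ a : k, C a ∈ S := fun a => S.algebraMap_mem a
      refine ⟨c * d, C c * t + C d * s + σ * s * t, add_mem (add_mem (mul_mem (hC _) ht)
        (mul_mem (hC _) hs)) (mul_mem (mul_mem hσS hs) ht), by rw [C_mul]; ring⟩
  have hdimS : ringKrullDim S ≤ 3 := hS ▸ ringKrullDim_quadricCone_le
  have h02 := hgen (X 0 * X 2) (by simp)
  have h03 := hgen (X 0 * X 3) (by simp)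
  have h12 := hgen (X 1 * X 2) (by simp)
  have h3R : 3 ≤ ringKrullDim R := three_le_ringKrullDim_subalgebra R
    (hσ ▸ hσR _ (sub_mem h02 h12)) (hσ ▸ hσR _ (sub_mem h02 h03)) (hσ ▸ hσmem)
  have h3S : 3 ≤ ringKrullDim S := three_le_ringKrullDim_subalgebra S
    (hσ ▸ hRS (hσR _ (sub_mem h02 h12))) (hσ ▸ hRS (hσR _ (sub_mem h02 h03))) (hσ ▸ hσS)
  have hfin : Algebra.FiniteType k S := by
    rw [← Subalgebra.fg_iff_finiteType, hS]
    exact Subalgebra.fg_def.2 ⟨_, by simp, rfl⟩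
  have hdimR : ringKrullDim R ≤ 3 := by
    refine ringKrullDim_le_of_eq_add_mul (n := 3) (Subalgebra.inclusion hRS)
      (Subalgebra.inclusion_injective hRS) ⟨σ, hσmem⟩ ?_ ?_ hdimS
    · intro s
      exact ⟨⟨σ * s, hσR s s.2⟩, rfl⟩
    · rintro ⟨r, hr⟩
      obtain ⟨c, s, hs, h⟩ := hdec r hr
      exact ⟨c, ⟨s, hs⟩, Subtype.ext h⟩
  refine ⟨?_, ?_, ?_, le_antisymm hdimS h3S⟩
  · intro hN
    let T : Subalgebra R (MvPolynomial (Fin 4) k) :=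
      { S with algebraMap_mem' := fun r => hRS r.2 }
    have hint : IsIntegral R (X 0 * X 2 : MvPolynomial (Fin 4) k) :=
      isIntegral_of_mul_mem_range T hσ0 (fun s hs => ⟨⟨σ * s, hσR s hs⟩, rfl⟩) h02
    let ψ : MvPolynomial (Fin 4) k →ₐ[k] Polynomial k := aeval ![Polynomial.X, 0, 1, 0]
    have := hint.map_of_comp_eq ((constantCoeff).comp (R.val : R →+* MvPolynomial (Fin 4) k))
      (ψ : MvPolynomial (Fin 4) k →+* Polynomial k) (by
        ext1 ⟨r, hr⟩
        obtain ⟨c, s, hs, rfl⟩ := hdec r hr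
        simp [ψ, hσ])
    have hX : IsIntegral k (Polynomial.X : Polynomial k) := by simpa [ψ] using this
    exact Polynomial.transcendental_X k hX.isAlgebraic
  · ext x
    constructor
    · rintro ⟨a, ha, b, hb, h⟩
      exact ⟨a, hRS ha, b, hRS hb, h⟩
    · rintro ⟨a, ha, b, hb, hb0, rfl⟩
      refine ⟨σ * a, hσR a ha, σ * b, hσR b hb, mul_ne_zero hσ0 hb0, ?_⟩
      subst hφ
      rw [map_mul, map_mul, mul_div_mul_left]
      simpa using hσ0
  · exact le_antisymm (hdimR.trans h3S) (hdimS.trans h3R)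
end

section
/- Let S be a finitely generated integral domain over a field k, R ⊆ S a subalgebra, and suppose there exists a nonempty subset of Max S on which R_{n∩R} = S_n. Then Frac R = Frac S and Krull dim R = Krull dim S. -/
/-- Localization of a subset `A` of a field at (the complement of) a subset `P`,
as a set of fractions `a / b` with `a, b ∈ A`, `b ∉ P`. -/
def locSet {F : Type*} [DivisionRing F] (A P : Set F) : Set F :=
  {x | ∃ a ∈ A, ∃ b ∈ A, b ∉ P ∧ x = a / b}

/-- An injective integral extension preserves the Krull dimension. -/
theorem ringKrullDim_eq_of_isIntegral_of_faithfulSMul (A B : Type*) [CommRing A] [CommRing B]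
    [Algebra A B] [Algebra.IsIntegral A B] [FaithfulSMul A B] :
    ringKrullDim B = ringKrullDim A := by
  apply le_antisymm
  · exact Order.krullDim_le_of_strictMono (PrimeSpectrum.comap (algebraMap A B))
      fun I J h ↦ Ideal.IsIntegral.comap_lt_comap (R := A) (I := I.asIdeal) (J := J.asIdeal) h
  · have : Algebra.HasGoingUp A B := Algebra.HasGoingUp.of_isIntegral
    refine iSup_le fun l ↦ ?_
    obtain ⟨P, hP, hPl⟩ := Ideal.nonempty_primesOver (S := B) l.head.asIdeal
    obtain ⟨L, hL, -, -⟩ := Ideal.exists_ltSeries_of_hasGoingUp l P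
    exact hL ▸ Order.LTSeries.length_le_krullDim L

/-- The Krull dimension of a finitely generated domain over a field is its transcendence degree. -/
theorem exists_trdeg_eq_and_ringKrullDim_eq (k A : Type*) [Field k] [CommRing A] [IsDomain A]
    [Algebra k A] [Algebra.FiniteType k A] :
    ∃ s : ℕ, Algebra.trdeg k A = s ∧ ringKrullDim A = s := by
  obtain ⟨s, g, hg, hint⟩ := exists_integral_inj_algHom_of_fg k A
  algebraize [g.toRingHom]
  have : IsScalarTower k (MvPolynomial (Fin s) k) A :=
    .of_algebraMap_eq fun x ↦ (g.commutes x).symm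
  have : FaithfulSMul (MvPolynomial (Fin s) k) A :=
    (faithfulSMul_iff_algebraMap_injective _ _).mpr hg
  refine ⟨s, ?_, ?_⟩
  · have h := lift_trdeg_add_eq k (MvPolynomial (Fin s) k) A
    rw [MvPolynomial.trdeg_of_isDomain, trdeg_eq_zero] at h
    simpa using h.symm
  · rw [ringKrullDim_eq_of_isIntegral_of_faithfulSMul (MvPolynomial (Fin s) k) A,
      MvPolynomial.ringKrullDim_of_isNoetherianRing]
    simp

/-- The Krull dimension is monotone along injections of finitely generated domains over a field. -/
theorem ringKrullDim_le_of_injective_algHom {k A B : Type*} [Field k] [CommRing A] [IsDomain A]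
    [Algebra k A] [Algebra.FiniteType k A] [CommRing B] [IsDomain B] [Algebra k B]
    [Algebra.FiniteType k B] (f : A →ₐ[k] B) (hf : Function.Injective f) :
    ringKrullDim A ≤ ringKrullDim B := by
  obtain ⟨s, hs, hs'⟩ := exists_trdeg_eq_and_ringKrullDim_eq k A
  obtain ⟨t, ht, ht'⟩ := exists_trdeg_eq_and_ringKrullDim_eq k B
  have h := lift_trdeg_le_of_injective f hf
  rw [hs, ht] at h
  rw [hs', ht']
  simpa using h

/-- The Krull dimension of an algebra is at most the supremum of the dimensions of its finitely
generated subalgebras. -/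
theorem ringKrullDim_le_of_forall_fg_subalgebra (k : Type*) {A : Type*} [CommRing k] [CommRing A]
    [Algebra k A] {d : WithBot ℕ∞} (h : ∀ B : Subalgebra k A, B.FG → ringKrullDim B ≤ d) :
    ringKrullDim A ≤ d := by
  refine iSup_le fun l ↦ ?_
  have hl (i : Fin l.length) :
      ∃ x ∈ (l i.succ).asIdeal, x ∉ (l i.castSucc).asIdeal :=
    (SetLike.lt_iff_le_and_exists.mp
      (show (l i.castSucc).asIdeal < (l i.succ).asIdeal from l.step i)).2
  choose x hx hx' using hl
  let B := Algebra.adjoin k (Set.range x)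
  have hB : B.FG := Subalgebra.fg_def.mpr ⟨_, Set.finite_range x, rfl⟩
  let L : LTSeries (PrimeSpectrum B) :=
    { length := l.length
      toFun := fun i ↦ PrimeSpectrum.comap (algebraMap B A) (l i)
      step := fun i ↦ by
        refine SetLike.lt_iff_le_and_exists.mpr ⟨Ideal.comap_mono (l.step i).le,
          ⟨x i, Algebra.subset_adjoin ⟨i, rfl⟩⟩, hx i, hx' i⟩ }
  exact (Order.LTSeries.length_le_krullDim L).trans (h B hB)

/-- Any subalgebra of a finitely generated domain `S` over a field has Krull dimension at most
that of `S`. -/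
theorem Subalgebra.ringKrullDim_le {k S : Type*} [Field k] [CommRing S] [IsDomain S] [Algebra k S]
    [Algebra.FiniteType k S] (R : Subalgebra k S) : ringKrullDim R ≤ ringKrullDim S := by
  refine ringKrullDim_le_of_forall_fg_subalgebra k fun B hB ↦ ?_
  have : Algebra.FiniteType k B := B.fg_iff_finiteType.mp hB
  exact ringKrullDim_le_of_injective_algHom (R.val.comp B.val)
    (Subtype.val_injective.comp Subtype.val_injective)

/-- Localization does not increase the Krull dimension. -/
theorem IsLocalization.ringKrullDim_le {A : Type*} [CommRing A] (M : Submonoid A) (B : Type*)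
    [CommRing B] [Algebra A B] [IsLocalization M B] : ringKrullDim B ≤ ringKrullDim A :=
  Order.krullDim_le_of_strictMono (PrimeSpectrum.comap (algebraMap A B))
    fun _ _ h ↦ (IsLocalization.orderEmbedding M B).strictMono h

/-- If `S` is finitely generated and each of its elements has a nonzero multiple in `R` by an
element of `R`, then powers of a single nonzero element of `R` suffice as multipliers. -/
theorem Subalgebra.exists_ne_zero_forall_pow_mul_mem {k S : Type*} [CommRing k] [CommRing S]
    [IsDomain S] [Algebra k S] [Algebra.FiniteType k S] (R : Subalgebra k S)
    (h : ∀ s : S, ∃ b ∈ R, b ≠ 0 ∧ b * s ∈ R) :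
    ∃ f ∈ R, f ≠ 0 ∧ ∀ s : S, ∃ m : ℕ, f ^ m * s ∈ R := by
  classical
  obtain ⟨t, ht⟩ := (Algebra.FiniteType.out : (⊤ : Subalgebra k S).FG)
  choose b hb hb0 hbs using h
  have hf : ∏ s ∈ t, b s ∈ R := prod_mem fun s _ ↦ hb s
  refine ⟨∏ s ∈ t, b s, hf, Finset.prod_ne_zero_iff.mpr fun s _ ↦ hb0 s, fun s ↦ ?_⟩
  have hs : s ∈ Algebra.adjoin k (t : Set S) := ht ▸ Algebra.mem_top
  induction hs using Algebra.adjoin_induction with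
  | mem s hs =>
    refine ⟨1, ?_⟩
    rw [pow_one, ← Finset.prod_erase_mul t b hs, mul_assoc]
    exact mul_mem (prod_mem fun s _ ↦ hb s) (hbs s)
  | algebraMap r => exact ⟨0, by simp⟩
  | add x y _ _ hx hy =>
    obtain ⟨m, hm⟩ := hx
    obtain ⟨n, hn⟩ := hy
    refine ⟨m + n, ?_⟩
    convert add_mem (mul_mem (pow_mem hf n) hm) (mul_mem (pow_mem hf m) hn) using 1
    ring
  | mul x y _ _ hx hy =>
    obtain ⟨m, hm⟩ := hx
    obtain ⟨n, hn⟩ := hy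
    refine ⟨m + n, ?_⟩
    convert mul_mem hm hn using 1
    ring

/-- A subalgebra of a finitely generated domain over a field with the same fraction field has the
same Krull dimension. -/
theorem Subalgebra.ringKrullDim_eq_of_forall_exists_mul_mem {k S : Type*} [Field k] [CommRing S]
    [IsDomain S] [Algebra k S] [Algebra.FiniteType k S] (R : Subalgebra k S)
    (h : ∀ s : S, ∃ b ∈ R, b ≠ 0 ∧ b * s ∈ R) : ringKrullDim R = ringKrullDim S := by
  refine le_antisymm R.ringKrullDim_le ?_
  obtain ⟨f, hfR, hf0, hf⟩ := R.exists_ne_zero_forall_pow_mul_mem h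
  have hM : Submonoid.powers f ≤ nonZeroDivisors S := powers_le_nonZeroDivisors_of_noZeroDivisors hf0
  let T := Localization.Away f
  have : IsDomain T := IsLocalization.isDomain_localization hM
  have : Algebra.FiniteType S T := IsLocalization.finiteType_of_monoid_fg (Submonoid.powers f) T
  have : Algebra.FiniteType k T := Algebra.FiniteType.trans ‹Algebra.FiniteType k S› this
  have hinj : Function.Injective (algebraMap S T) := IsLocalization.injective T hM
  have : IsLocalization (Submonoid.powers (⟨f, hfR⟩ : R)) T := by
    refine ⟨?_, ?_, ?_⟩
    · rintro ⟨_, n, rfl⟩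
      exact IsLocalization.map_units T (⟨f ^ n, n, rfl⟩ : Submonoid.powers f)
    · intro z
      obtain ⟨⟨s, _, n, rfl⟩, hs⟩ := IsLocalization.surj (Submonoid.powers f) z
      obtain ⟨m, hm⟩ := hf s
      refine ⟨⟨⟨f ^ m * s, hm⟩, ⟨_, m + n, rfl⟩⟩, ?_⟩
      change z * algebraMap S T (f ^ n) = algebraMap S T s at hs
      change z * algebraMap S T (f ^ (m + n)) = algebraMap S T (f ^ m * s)
      rw [map_mul, ← hs, pow_add, map_mul]
      ring
    · intro x y hxy
      exact ⟨1, by rw [Subtype.ext (hinj hxy)]⟩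
  exact (ringKrullDim_le_of_injective_algHom (IsScalarTower.toAlgHom k S T) hinj).trans
    (IsLocalization.ringKrullDim_le (Submonoid.powers (⟨f, hfR⟩ : R)) T)

/-- Let `S` be a finitely generated integral domain over a field `k`,
`R ⊆ S` a subalgebra, and suppose there is a maximal ideal `n` of `S` with
`R_{n∩R} = S_n` inside `Frac S`. Then `Frac R = Frac S` and
`Krull dim R = Krull dim S`. -/
theorem stmt_19 (k : Type*) [Field k]
    (S : Type*) [CommRing S] [IsDomain S] [Algebra k S] [Algebra.FiniteType k S]
    (R : Subalgebra k S)
    (φ : S → FractionRing S) (hφ : φ = algebraMap S (FractionRing S))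
    (hloc : ∃ n : Ideal S, n.IsMaximal ∧
      locSet (φ '' R) (φ '' ((n : Set S) ∩ R)) = locSet (Set.range φ) (φ '' n)) :
    {x : FractionRing S | ∃ a ∈ R, ∃ b ∈ R, b ≠ 0 ∧ x = φ a / φ b}
        = {x : FractionRing S | ∃ a : S, ∃ b : S, b ≠ 0 ∧ x = φ a / φ b} ∧
      ringKrullDim R = ringKrullDim S := by
  subst hφ
  obtain ⟨n, hn, hloc⟩ := hloc
  have hinj : Function.Injective (algebraMap S (FractionRing S)) := IsFractionRing.injective _ _
  have key (s : S) : ∃ b ∈ R, b ≠ 0 ∧ b * s ∈ R := by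
    have hs : algebraMap S (FractionRing S) s ∈
        locSet (Set.range (algebraMap S (FractionRing S))) (algebraMap S (FractionRing S) '' n) := by
      refine ⟨_, ⟨s, rfl⟩, _, ⟨1, rfl⟩, ?_, by simp⟩
      rintro ⟨x, hx, hx1⟩
      exact hn.ne_top ((Ideal.eq_top_iff_one n).mpr (hinj hx1 ▸ hx))
    rw [← hloc] at hs
    obtain ⟨_, ⟨a, ha, rfl⟩, _, ⟨b, hb, rfl⟩, hbn, hab⟩ := hs
    have hb0 : b ≠ 0 := by
      rintro rfl
      exact hbn ⟨0, ⟨n.zero_mem, R.zero_mem⟩, rfl⟩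
    refine ⟨b, hb, hb0, ?_⟩
    rw [eq_div_iff ((map_ne_zero_iff _ hinj).mpr hb0), ← map_mul] at hab
    rw [mul_comm, hinj hab]
    exact ha
  refine ⟨?_, R.ringKrullDim_eq_of_forall_exists_mul_mem key⟩
  ext x
  constructor
  · rintro ⟨a, -, b, -, h⟩
    exact ⟨a, b, h⟩
  · rintro ⟨a, b, hb, rfl⟩
    obtain ⟨c, hc, hc0, hca⟩ := key a
    obtain ⟨d, hd, hd0, hdb⟩ := key b
    refine ⟨d * (c * a), mul_mem hd hca, c * (d * b), mul_mem hc hdb,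
      mul_ne_zero hc0 (mul_ne_zero hd0 hb), ?_⟩
    have hb' := (map_ne_zero_iff _ hinj).mpr hb
    have hc' := (map_ne_zero_iff _ hinj).mpr hc0
    have hd' := (map_ne_zero_iff _ hinj).mpr hd0
    simp only [map_mul]
    field_simp
end
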